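/- Let m ≥ 2 and let Γ be an (m+2)-angulation of the annulus A(p,q). Let F be a face of Γ having among its sides at least one bottom boundary segment and at least one top boundary segment. Then exactly two sides of F are bridging arcs, say β(x,y) and β(x′,y′), and their bottom endpoints satisfy x ≢ x′ (mod m); consequently the corresponding objects lie in different transjective components of the Auslander–Reiten quiver of the m-cluster category. -/

import Mathlib

namespace ClusterAnnulus

/-! ## The combinatorial model of the annulus `A(p,q)`

We model the annulus `A(p,q)` by the strip `S = ℝ × [0,1]` together with the shift `σ`
acting by `σ(x,0) = (x + m·p, 0)` on the bottom boundary and `σ(x,1) = (x + m·q, 1)` on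
the top boundary.  Marked points are `(i,0)` and `(j,1)` for integers `i, j`. -/

/-- Marked points on the two boundary lines of the strip: `Pt.bot x` is the point
`(x,0)` and `Pt.top x` is the point `(x,1)`. -/
inductive Pt : Type
  | bot : ℤ → Pt
  | top : ℤ → Pt
  deriving DecidableEq

/-- Combinatorial (isotopy classes of) arcs in the strip:
* `bridging x y` is the straight segment from `(x,0)` to `(y,1)`;
* `botPeriph u v` is an embedded arc in the open strip joining `(u,0)` to `(v,0)`;
* `topPeriph u v` is an embedded arc in the open strip joining `(u,1)` to `(v,1)`. -/
inductive Arc : Type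
  | bridging : ℤ → ℤ → Arc
  | botPeriph : ℤ → ℤ → Arc
  | topPeriph : ℤ → ℤ → Arc
  deriving DecidableEq

/-- An arc is bridging if it joins the two boundary components. -/
def Arc.IsBridging : Arc → Prop
  | .bridging _ _ => True
  | _ => False

/-- `m`-arc conditions: a bridging arc `β(x,y)` requires `x ≡ y (mod m)`; a peripheral
arc `π(u,v)` requires `v = u + k·m + 1` for some `k ≥ 1`. -/
def IsMArc (m : ℕ) : Arc → Prop
  | .bridging x y => x ≡ y [ZMOD (m : ℤ)]
  | .botPeriph u v => ∃ k : ℤ, 1 ≤ k ∧ v = u + k * (m : ℤ) + 1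
  | .topPeriph u v => ∃ k : ℤ, 1 ≤ k ∧ v = u + k * (m : ℤ) + 1

/-- The combinatorial crossing relation between arcs. -/
def Cross : Arc → Arc → Prop
  | .bridging x y, .bridging x' y' => (x - x') * (y - y') < 0
  | .bridging x _, .botPeriph u v => u < x ∧ x < v
  | .botPeriph u v, .bridging x _ => u < x ∧ x < v
  | .bridging _ y, .topPeriph u v => u < y ∧ y < v
  | .topPeriph u v, .bridging _ y => u < y ∧ y < v
  | .botPeriph u v, .botPeriph u' v' => (u < u' ∧ u' < v ∧ v < v') ∨ (u' < u ∧ u < v' ∧ v' < v)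
  | .topPeriph u v, .topPeriph u' v' => (u < u' ∧ u' < v ∧ v < v') ∨ (u' < u ∧ u < v' ∧ v' < v)
  | .botPeriph _ _, .topPeriph _ _ => False
  | .topPeriph _ _, .botPeriph _ _ => False

/-- The `n`-th power of the shift `σ` acting on arcs: it translates bottom endpoints
by `n·m·p` and top endpoints by `n·m·q`. -/
def shiftArc (m p q : ℕ) (n : ℤ) : Arc → Arc
  | .bridging x y => .bridging (x + n * ((m : ℤ) * p)) (y + n * ((m : ℤ) * q))
  | .botPeriph u v => .botPeriph (u + n * ((m : ℤ) * p)) (v + n * ((m : ℤ) * p))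
  | .topPeriph u v => .topPeriph (u + n * ((m : ℤ) * q)) (v + n * ((m : ℤ) * q))

/-- Two arcs lie in the same `σ`-orbit. -/
def SameOrbit (m p q : ℕ) (a b : Arc) : Prop := ∃ n : ℤ, shiftArc m p q n a = b

/-- Possible sides of a face of an `(m+2)`-angulation of the strip: an arc, a bottom
boundary segment `[i,i+1] × {0}`, or a top boundary segment `[j,j+1] × {1}`. -/
inductive Side : Type
  | arc : Arc → Side
  | botSeg : ℤ → Side
  | topSeg : ℤ → Side
  deriving DecidableEq

/-- The endpoints of an arc. -/
def Arc.endpoints : Arc → Finset Pt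
  | .bridging x y => {Pt.bot x, Pt.top y}
  | .botPeriph u v => {Pt.bot u, Pt.bot v}
  | .topPeriph u v => {Pt.top u, Pt.top v}

/-- The endpoints of a side. -/
def Side.endpoints : Side → Finset Pt
  | .arc a => a.endpoints
  | .botSeg i => {Pt.bot i, Pt.bot (i + 1)}
  | .topSeg j => {Pt.top j, Pt.top (j + 1)}

/-- The `n`-th power of the shift `σ` acting on sides. -/
def shiftSide (m p q : ℕ) (n : ℤ) : Side → Side
  | .arc a => .arc (shiftArc m p q n a)
  | .botSeg i => .botSeg (i + n * ((m : ℤ) * p))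
  | .topSeg j => .topSeg (j + n * ((m : ℤ) * q))

/-- A rational "angle key" recording the counterclockwise angular position, at a marked
point, of an arc incident to that marked point (junk value `37` if the point is not an
endpoint of the arc).  Arcs incident to a common marked point are pairwise noncrossing
in an angulation, and their angular order around the point is strictly monotone in this
key. -/
def angKey : Arc → Pt → ℚ
  | .bridging x y, .bot z =>
      if z = x then 1 / 2 - (y : ℚ) / (2 * (1 + |(y : ℚ)|)) else 37
  | .bridging x y, .top z =>
      if z = y then -1 + (x : ℚ) / (2 * (1 + |(x : ℚ)|)) else 37
  | .botPeriph u v, .bot z =>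
      if z = u then -1 / ((v : ℚ) - (u : ℚ))
      else if z = v then 2 - 1 / ((v : ℚ) - (u : ℚ)) else 37
  | .topPeriph u v, .top z =>
      if z = u then 1 / ((v : ℚ) - (u : ℚ))
      else if z = v then -2 - 1 / ((v : ℚ) - (u : ℚ)) else 37
  | _, _ => 37

/-- `CwFollows a b pt` : the arcs `a` and `b` are both incident to the marked point
`pt` and `a` follows `b` in the clockwise direction around `pt` (i.e. the
counterclockwise angle of `a` at `pt` is smaller than that of `b`). -/
def CwFollows (a b : Arc) (pt : Pt) : Prop :=
  pt ∈ a.endpoints ∧ pt ∈ b.endpoints ∧ angKey a pt < angKey b pt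

/-- An `(m+2)`-angulation of the annulus `A(p,q)`, presented in the universal cover:
a `σ`-invariant set of pairwise noncrossing `m`-arcs with exactly `p + q` orbits
under `σ`, together with its set of faces; every face has exactly `m+2` sides, each
side of a face is an arc of the angulation or a boundary segment, each arc bounds
exactly two faces, each boundary segment bounds exactly one face, and around each
marked point a face has either no sides or exactly two sides (polygon condition). -/
structure Angulation (m p q : ℕ) : Type where
  arcs : Set Arc
  faces : Set (Finset Side)
  marc : ∀ a ∈ arcs, IsMArc m a
  shift_mem : ∀ a : Arc, a ∈ arcs ↔ shiftArc m p q 1 a ∈ arcs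
  noncross : ∀ a ∈ arcs, ∀ b ∈ arcs, ¬ Cross a b
  orbit_count : ∃ reps : Finset Arc, reps.card = p + q ∧ ↑reps ⊆ arcs ∧
      (∀ a ∈ arcs, ∃ r ∈ reps, SameOrbit m p q a r) ∧
      (∀ r ∈ reps, ∀ r' ∈ reps, SameOrbit m p q r r' → r = r')
  face_card : ∀ F ∈ faces, F.card = m + 2
  face_sides : ∀ F ∈ faces, ∀ s ∈ F,
      (∃ a ∈ arcs, s = Side.arc a) ∨ (∃ i : ℤ, s = Side.botSeg i) ∨ (∃ j : ℤ, s = Side.topSeg j)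
  shift_face : ∀ F : Finset Side, F ∈ faces ↔ F.image (shiftSide m p q 1) ∈ faces
  arc_two_faces : ∀ a ∈ arcs, ∃ F ∈ faces, ∃ G ∈ faces, F ≠ G ∧
      Side.arc a ∈ F ∧ Side.arc a ∈ G ∧ ∀ H ∈ faces, Side.arc a ∈ H → H = F ∨ H = G
  botSeg_face : ∀ i : ℤ, ∃! F : Finset Side, F ∈ faces ∧ Side.botSeg i ∈ F
  topSeg_face : ∀ j : ℤ, ∃! F : Finset Side, F ∈ faces ∧ Side.topSeg j ∈ F
  face_polygon : ∀ F ∈ faces, ∀ pt : Pt,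
      (F.filter (fun s => pt ∈ s.endpoints)).card = 0 ∨
      (F.filter (fun s => pt ∈ s.endpoints)).card = 2

section Abstract
variable {ι : Type} [DecidableEq ι]

/-- nestedness of intervals -/
def Nst (l r : ι → ℤ) (a e : ι) : Prop := l e ≤ l a ∧ r a ≤ r e

structure Sys (l r : ι → ℤ) (m : ℕ) (E : Set ι) : Prop where
  lt : ∀ e ∈ E, l e < r e
  md : ∀ e ∈ E, (m : ℤ) ∣ r e - l e - 1
  inj : ∀ a ∈ E, ∀ b ∈ E, l a = l b → r a = r b → a = b
  nc : ∀ a ∈ E, ∀ b ∈ E, ¬ (l a < l b ∧ l b < r a ∧ r a < r b)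

structure FaceData (l r : ι → ℤ) (E : Set ι) (P : Finset ι) (br : ℤ → ℕ) : Prop where
  sub : ∀ a ∈ P, a ∈ E
  deg : ∀ z : ℤ, (P.filter (fun a => l a = z)).card + (P.filter (fun a => r a = z)).card + br z = 0
    ∨ (P.filter (fun a => l a = z)).card + (P.filter (fun a => r a = z)).card + br z = 2
  brnc : ∀ z : ℤ, br z ≠ 0 → ∀ e ∈ E, ¬ (l e < z ∧ z < r e)

/-- no two distinct nested elements -/
def NoNest (l r : ι → ℤ) (S : Finset ι) : Prop := ∀ a ∈ S, ∀ b ∈ S, Nst l r a b → a = b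

lemma flow (l r : ι → ℤ) (S : Finset ι) (Z : Finset ℤ) (hl : ∀ a ∈ S, l a ∈ Z)
    (hr : ∀ a ∈ S, r a ∈ Z) (f : ℤ → ℤ) :
    ∑ a ∈ S, (f (r a) - f (l a)) = ∑ z ∈ Z, f z *
      (((S.filter (fun a => r a = z)).card : ℤ) - ((S.filter (fun a => l a = z)).card : ℤ)) := by
  have key : ∀ g : ι → ℤ, (∀ a ∈ S, g a ∈ Z) →
      ∑ a ∈ S, f (g a) = ∑ z ∈ Z, f z * ((S.filter (fun a => g a = z)).card : ℤ) := by
    intro g hg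
    rw [← Finset.sum_fiberwise_of_maps_to hg]
    refine Finset.sum_congr rfl fun z _ => ?_
    rw [Finset.sum_congr rfl (g := fun _ => f z)]
    · simp [mul_comm]
    · intro a ha
      rw [(Finset.mem_filter.1 ha).2]
  rw [Finset.sum_sub_distrib, key r hr, key l hl, ← Finset.sum_sub_distrib]
  exact Finset.sum_congr rfl fun z _ => by ring

lemma NoNest.left {l r : ι → ℤ} {S : Finset ι} (h : NoNest l r S) (z : ℤ) :
    (S.filter (fun a => l a = z)).card ≤ 1 := by
  rw [Finset.card_le_one]
  intro a ha b hb
  simp only [Finset.mem_filter] at ha hb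
  rcases le_total (r a) (r b) with h1 | h1
  · exact h a ha.1 b hb.1 ⟨by omega, h1⟩
  · exact (h b hb.1 a ha.1 ⟨by omega, h1⟩).symm

lemma NoNest.right {l r : ι → ℤ} {S : Finset ι} (h : NoNest l r S) (z : ℤ) :
    (S.filter (fun a => r a = z)).card ≤ 1 := by
  rw [Finset.card_le_one]
  intro a ha b hb
  simp only [Finset.mem_filter] at ha hb
  rcases le_total (l a) (l b) with h1 | h1
  · exact (h b hb.1 a ha.1 ⟨h1, by omega⟩).symm
  · exact h a ha.1 b hb.1 ⟨h1, by omega⟩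

open Classical in
/-- strictly nested part -/
noncomputable def ins (l r : ι → ℤ) (P : Finset ι) (e : ι) : Finset ι :=
  P.filter (fun a => a ≠ e ∧ Nst l r a e)

lemma mem_ins {l r : ι → ℤ} {P : Finset ι} {e a : ι} :
    a ∈ ins l r P e ↔ a ∈ P ∧ a ≠ e ∧ Nst l r a e := by
  simp [ins]

lemma sum_pos_len {l r : ι → ℤ} {m : ℕ} {E : Set ι} (hS : Sys l r m E) {S : Finset ι}
    (hE : ∀ a ∈ S, a ∈ E) (hne : S.Nonempty) : 0 < ∑ a ∈ S, (r a - l a) :=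
  Finset.sum_pos (fun a ha => by have := hS.lt a (hE a ha); omega) hne

lemma chain {l r : ι → ℤ} {m : ℕ} {E : Set ι} (hS : Sys l r m E) {P : Finset ι} {br : ℤ → ℕ}
    (hP : FaceData l r E P br) {e : ι} (he : e ∈ E) (hne : (ins l r P e).Nonempty)
    (hnn : NoNest l r (ins l r P e)) :
    (∀ f : ℤ → ℤ, ∑ a ∈ ins l r P e, (f (r a) - f (l a)) = f (r e) - f (l e)) ∧
      m + 1 ≤ (ins l r P e).card := by
  set S := ins l r P e with hSdef
  have hSE : ∀ a ∈ S, a ∈ E := fun a ha => hP.sub a (mem_ins.1 ha).1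
  have hlt := hS.lt e he
  -- balanced at interior points
  have hint : ∀ z, l e < z → z < r e →
      (S.filter (fun a => r a = z)).card = (S.filter (fun a => l a = z)).card := by
    intro z h1 h2
    have hb : br z = 0 := by
      by_contra h
      exact hP.brnc z h e he ⟨h1, h2⟩
    have e1 : S.filter (fun a => r a = z) = P.filter (fun a => r a = z) := by
      ext a
      simp only [Finset.mem_filter, hSdef, mem_ins]
      constructor
      · rintro ⟨⟨h, -⟩, h'⟩; exact ⟨h, h'⟩
      · rintro ⟨h, h'⟩
        refine ⟨⟨h, ?_, ?_, by omega⟩, h'⟩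
        · rintro rfl; omega
        · by_contra h3
          exact hS.nc a (hP.sub a h) e he ⟨by omega, by omega, by omega⟩
    have e2 : S.filter (fun a => l a = z) = P.filter (fun a => l a = z) := by
      ext a
      simp only [Finset.mem_filter, hSdef, mem_ins]
      constructor
      · rintro ⟨⟨h, -⟩, h'⟩; exact ⟨h, h'⟩
      · rintro ⟨h, h'⟩
        refine ⟨⟨h, ?_, by omega, ?_⟩, h'⟩
        · rintro rfl; omega
        · by_contra h3
          exact hS.nc e he a (hP.sub a h) ⟨by omega, by omega, by omega⟩
    have h3 := hnn.left z
    have h4 := hnn.right z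
    have h5 := hP.deg z
    rw [e1] at h4 ⊢
    rw [e2] at h3 ⊢
    omega
  have hL : (S.filter (fun a => l a = r e)).card = 0 := by
    rw [Finset.card_eq_zero, Finset.filter_eq_empty_iff]
    intro a ha h
    have := hS.lt a (hSE a ha)
    have := (mem_ins.1 ha).2.2.2
    omega
  have hR : (S.filter (fun a => r a = l e)).card = 0 := by
    rw [Finset.card_eq_zero, Finset.filter_eq_empty_iff]
    intro a ha h
    have := hS.lt a (hSE a ha)
    have := (mem_ins.1 ha).2.2.1
    omega
  have hl' : ∀ a ∈ S, l a ∈ Finset.Icc (l e) (r e) := by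
    intro a ha
    have := hS.lt a (hSE a ha)
    have := (mem_ins.1 ha).2.2
    simp only [Nst] at this
    simp; omega
  have hr' : ∀ a ∈ S, r a ∈ Finset.Icc (l e) (r e) := by
    intro a ha
    have := hS.lt a (hSE a ha)
    have := (mem_ins.1 ha).2.2
    simp only [Nst] at this
    simp; omega
  have hflow : ∀ f : ℤ → ℤ, ∑ a ∈ S, (f (r a) - f (l a)) =
      f (r e) * ((S.filter (fun a => r a = r e)).card : ℤ) -
      f (l e) * ((S.filter (fun a => l a = l e)).card : ℤ) := by
    intro f
    rw [flow l r S _ hl' hr' f]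
    rw [← Finset.sum_subset (s₁ := {l e, r e})]
    · rw [Finset.sum_pair (by omega), hL, hR]
      push_cast; ring
    · intro z hz
      simp only [Finset.mem_insert, Finset.mem_singleton] at hz
      simp; omega
    · intro z hz hz'
      simp only [Finset.mem_insert, Finset.mem_singleton, Finset.mem_Icc] at hz hz'
      rw [hint z (by omega) (by omega)]
      ring
  have hone := hflow (fun _ => 1)
  have hid := hflow id
  have hpos := sum_pos_len hS hSE hne
  simp only [id, sub_self, Finset.sum_const_zero] at hone hid
  have h3 := hnn.left (l e)
  have h4 := hnn.right (r e)
  have hR1 : (S.filter (fun a => r a = r e)).card = 1 := by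
    by_contra h
    have a1 : (S.filter (fun a => r a = r e)).card = 0 := by omega
    have a2 : (S.filter (fun a => l a = l e)).card = 0 := by omega
    rw [a1, a2] at hid
    simp at hid
    simp only [Finset.sum_sub_distrib] at hpos
    omega
  have hL1 : (S.filter (fun a => l a = l e)).card = 1 := by omega
  have hmain : ∀ f : ℤ → ℤ, ∑ a ∈ S, (f (r a) - f (l a)) = f (r e) - f (l e) := by
    intro f
    rw [hflow f, hR1, hL1]
    push_cast; ring
  refine ⟨hmain, ?_⟩
  have hd : (m : ℤ) ∣ ∑ a ∈ S, (r a - l a - 1) :=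
    Finset.dvd_sum fun a ha => hS.md a (hSE a ha)
  have hs : ∑ a ∈ S, (r a - l a - 1) = (r e - l e - 1) - ((S.card : ℤ) - 1) := by
    have := hmain id
    simp only [id] at this
    rw [Finset.sum_sub_distrib, this]
    simp
  rw [hs] at hd
  have hd2 : (m : ℤ) ∣ (S.card : ℤ) - 1 := by
    have := dvd_sub (hS.md e he) hd
    simpa using this
  have hc0 : 0 < S.card := Finset.card_pos.2 hne
  have hc1 : S.card ≠ 1 := by
    intro h
    obtain ⟨a, ha⟩ := Finset.card_eq_one.1 h
    have haS : a ∈ S := by rw [ha]; simp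
    have := hmain id
    rw [ha] at this
    simp at this
    have h2 := (mem_ins.1 haS).2.2
    simp only [Nst] at h2
    exact (mem_ins.1 haS).2.1 (hS.inj a (hSE a haS) e he (by omega) (by omega))
  have := Int.le_of_dvd (by omega) hd2
  omega

lemma outer_struct {l r : ι → ℤ} {m : ℕ} {E : Set ι} (hS : Sys l r m E) {P : Finset ι}
    {br : ℤ → ℕ} (hP : FaceData l r E P br) (hc : P.card ≤ m + 2) {e : ι} (he : e ∈ P)
    (hne : (ins l r P e).Nonempty) :
    NoNest l r (ins l r P e) ∧ (ins l r P e).card = m + 1 ∧ P = insert e (ins l r P e) := by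
  classical
  -- minimal outer element
  obtain ⟨e0, he0, hmin⟩ := Finset.exists_min_image
    (P.filter (fun a => Nst l r a e ∧ (ins l r P a).Nonempty)) (fun a => r a - l a)
    ⟨e, Finset.mem_filter.2 ⟨he, ⟨le_rfl, le_rfl⟩, hne⟩⟩
  simp only [Finset.mem_filter] at he0 hmin
  obtain ⟨he0P, hn0, hne0⟩ := he0
  have hnn : NoNest l r (ins l r P e0) := by
    intro a ha b hb hab
    by_contra hne'
    rw [mem_ins] at ha hb
    have hbm := hmin b ⟨hb.1, ⟨by have := hb.2.2.1; have := hn0.1; omega,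
      by have := hb.2.2.2; have := hn0.2; omega⟩, a, mem_ins.2 ⟨ha.1, hne', hab⟩⟩
    have h1 := hb.2.2.1
    have h2 := hb.2.2.2
    exact hb.2.1 (hS.inj b (hP.sub b hb.1) e0 (hP.sub _ he0P) (by omega) (by omega))
  have hch := (chain hS hP (hP.sub _ he0P) hne0 hnn).2
  have hni : e0 ∉ ins l r P e0 := by simp [mem_ins]
  have hsub : insert e0 (ins l r P e0) ⊆ P := by
    intro a ha
    rcases Finset.mem_insert.1 ha with rfl | h
    · exact he0P
    · exact (mem_ins.1 h).1
  have hcard := Finset.card_insert_of_notMem hni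
  have heq : insert e0 (ins l r P e0) = P := Finset.eq_of_subset_of_card_le hsub (by omega)
  have hee : e = e0 := by
    by_contra hne'
    have h : e ∈ insert e0 (ins l r P e0) := by rw [heq]; exact he
    rcases Finset.mem_insert.1 h with h | h
    · exact hne' h
    · have h1 := (mem_ins.1 h).2.2.1
      have h2 := (mem_ins.1 h).2.2.2
      have h3 := hn0.1
      have h4 := hn0.2
      exact hne' (hS.inj e (hP.sub e he) e0 (hP.sub _ he0P) (by omega) (by omega))
  subst hee
  refine ⟨hnn, ?_, heq.symm⟩
  have := Finset.card_le_card hsub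
  omega

lemma no_strict {l r : ι → ℤ} {m : ℕ} {E : Set ι} (hS : Sys l r m E) {Q : Finset ι}
    {br : ℤ → ℕ} (hQ : FaceData l r E Q br) (hc : Q.card ≤ m + 2) {e : ι} (he : e ∈ Q)
    (hne : (ins l r Q e).Nonempty) {a b : ι} (ha : a ∈ E) (hae : Nst l r a e) (hae' : a ≠ e)
    (hb : b ∈ Q) (hba : Nst l r b a) : b = a := by
  by_contra hne'
  obtain ⟨hnn, hcard, -⟩ := outer_struct hS hQ hc he hne
  have hsub : ins l r Q a ⊆ ins l r Q e := by
    intro c hc'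
    obtain ⟨h1, h2, h3⟩ := mem_ins.1 hc'
    have h4 := h3.1
    have h5 := h3.2
    have h6 := hae.1
    have h7 := hae.2
    refine mem_ins.2 ⟨h1, ?_, by omega, by omega⟩
    rintro rfl
    exact hae' (hS.inj a ha c (hQ.sub c he) (by omega) (by omega))
  have hna : (ins l r Q a).Nonempty := ⟨b, mem_ins.2 ⟨hb, hne', hba⟩⟩
  have hch := chain hS hQ ha hna (fun x hx y hy => hnn x (hsub hx) y (hsub hy))
  have heq : ins l r Q a = ins l r Q e :=
    Finset.eq_of_subset_of_card_le hsub (by omega)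
  have h1 := hch.1 id
  have h2 := (chain hS hQ (hQ.sub e he) hne hnn).1 id
  rw [heq, h2] at h1
  simp only [id] at h1
  have h6 := hae.1
  have h7 := hae.2
  exact hae' (hS.inj a ha e (hQ.sub e he) (by omega) (by omega))

lemma outer_sub {l r : ι → ℤ} {m : ℕ} {E : Set ι} (hS : Sys l r m E) {P Q : Finset ι}
    {br br' : ℤ → ℕ} (hP : FaceData l r E P br) (hQ : FaceData l r E Q br')
    (hcP : P.card ≤ m + 2) (hcQ : Q.card ≤ m + 2) {e : ι} (heP : e ∈ P) (heQ : e ∈ Q)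
    (hneP : (ins l r P e).Nonempty) (hneQ : (ins l r Q e).Nonempty) : Q ⊆ P := by
  obtain ⟨hnnP, -, hPe⟩ := outer_struct hS hP hcP heP hneP
  obtain ⟨-, -, hQe⟩ := outer_struct hS hQ hcQ heQ hneQ
  intro b hb
  by_cases hbe : b = e
  · rw [hbe]; exact heP
  have hb' : b ∈ ins l r Q e := by
    rw [hQe] at hb
    exact Finset.mem_of_mem_insert_of_ne hb hbe
  obtain ⟨-, -, hbn⟩ := mem_ins.1 hb'
  have hb1 := hbn.1
  have hb2 := hbn.2
  have hbl := hS.lt b (hQ.sub b hb)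
  have hcov := (chain hS hP (hP.sub e heP) hneP hnnP).1 (fun z => if l b < z then 1 else 0)
  simp only [show l b < r e by omega, show ¬ l b < l e by omega, if_true, if_false] at hcov
  obtain ⟨a, ha, hane⟩ := Finset.exists_ne_zero_of_sum_ne_zero
    (f := fun a => ((if l b < r a then 1 else 0) - (if l b < l a then 1 else 0) : ℤ))
    (s := ins l r P e) (by rw [hcov]; norm_num)
  obtain ⟨haP, hae, han⟩ := mem_ins.1 ha
  have hal := hS.lt a (hP.sub a haP)
  have hlr : l a ≤ l b ∧ l b < r a := by
    split_ifs at hane <;> first | (exfalso; simp at hane; done) | omega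
  have hab : a = b := by
    by_cases hn : Nst l r b a
    · exact (no_strict hS hQ hcQ heQ hneQ (hP.sub a haP) han hae hb hn).symm
    · have hn2 : Nst l r a b := by
        have h1 := hS.nc a (hP.sub a haP) b (hQ.sub b hb)
        simp only [Nst] at hn ⊢
        omega
      exact no_strict hS hP hcP heP hneP (hQ.sub b hb) hbn hbe haP hn2
  rw [← hab]; exact haP

lemma no_br_zero {l r : ι → ℤ} {m : ℕ} {E : Set ι} (hS : Sys l r m E) {P : Finset ι}
    {br : ℤ → ℕ} (hP : FaceData l r E P br) (hnn : NoNest l r P) (hne : P.Nonempty)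
    (hbr : ∀ z, br z = 0) : False := by
  have h := flow l r P (P.image l ∪ P.image r)
    (fun a ha => Finset.mem_union_left _ (Finset.mem_image_of_mem l ha))
    (fun a ha => Finset.mem_union_right _ (Finset.mem_image_of_mem r ha)) id
  rw [Finset.sum_eq_zero (s := P.image l ∪ P.image r)] at h
  · have := sum_pos_len hS hP.sub hne
    simp only [id] at h
    omega
  · intro z _
    have h1 := hnn.left z
    have h2 := hnn.right z
    have h3 := hP.deg z
    have h4 := hbr z
    have : (P.filter (fun a => r a = z)).card = (P.filter (fun a => l a = z)).card := by omega
    rw [this]; ring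

lemma no_br_one {l r : ι → ℤ} {E : Set ι} {P : Finset ι}
    {br : ℤ → ℕ} (hP : FaceData l r E P br) (hnn : NoNest l r P) (x : ℤ)
    (hbr : ∀ z, br z = if z = x then 1 else 0) : False := by
  have h := flow l r P (insert x (P.image l ∪ P.image r))
    (fun a ha => Finset.mem_insert_of_mem
      (Finset.mem_union_left _ (Finset.mem_image_of_mem l ha)))
    (fun a ha => Finset.mem_insert_of_mem
      (Finset.mem_union_right _ (Finset.mem_image_of_mem r ha))) (fun _ => 1)
  rw [Finset.sum_eq_single_of_mem (s := insert x (P.image l ∪ P.image r)) x (by simp)] at h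
  · have h1 := hnn.left x
    have h2 := hnn.right x
    have h3 := hP.deg x
    have h4 := hbr x
    simp at h4
    simp at h
    omega
  · intro z _ hz
    have h1 := hnn.left z
    have h2 := hnn.right z
    have h3 := hP.deg z
    have h4 := hbr z
    rw [if_neg hz] at h4
    have : (P.filter (fun a => r a = z)).card = (P.filter (fun a => l a = z)).card := by omega
    rw [this]; ring

lemma br_two {l r : ι → ℤ} {m : ℕ} {E : Set ι} (hS : Sys l r m E) {P : Finset ι}
    {br : ℤ → ℕ} (hP : FaceData l r E P br) (hnn : NoNest l r P) (hne : P.Nonempty) (x x' : ℤ)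
    (hbr : ∀ z, br z = (if z = x then 1 else 0) + (if z = x' then 1 else 0)) :
    (m : ℤ) ∣ x' - x - P.card ∨ (m : ℤ) ∣ x - x' - P.card := by
  have hd : (m : ℤ) ∣ ∑ a ∈ P, (r a - l a - 1) :=
    Finset.dvd_sum fun a ha => hS.md a (hP.sub a ha)
  rw [Finset.sum_sub_distrib] at hd
  simp only [Finset.sum_const, nsmul_eq_mul, mul_one] at hd
  have h := flow l r P (insert x (insert x' (P.image l ∪ P.image r)))
    (fun a ha => Finset.mem_insert_of_mem (Finset.mem_insert_of_mem
      (Finset.mem_union_left _ (Finset.mem_image_of_mem l ha))))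
    (fun a ha => Finset.mem_insert_of_mem (Finset.mem_insert_of_mem
      (Finset.mem_union_right _ (Finset.mem_image_of_mem r ha))))
  have hpos := sum_pos_len hS hP.sub hne
  have hz : ∀ z, z ≠ x → z ≠ x' →
      (P.filter (fun a => r a = z)).card = (P.filter (fun a => l a = z)).card := by
    intro z h1' h2'
    have h1 := hnn.left z
    have h2 := hnn.right z
    have h3 := hP.deg z
    have h4 := hbr z
    rw [if_neg h1', if_neg h2'] at h4
    omega
  have h1 := hnn.left x
  have h2 := hnn.right x
  have h3 := hP.deg x
  have h4 := hbr x
  have h1' := hnn.left x'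
  have h2' := hnn.right x'
  have h3' := hP.deg x'
  have h4' := hbr x'
  by_cases hx : x = x'
  · exfalso
    subst hx
    have h5 := h id
    rw [Finset.sum_eq_zero (s := insert x (insert x (P.image l ∪ P.image r)))] at h5
    · simp only [id] at h5
      omega
    · intro z _
      by_cases hzx : z = x
      · subst hzx
        simp at h4
        have : (P.filter (fun a => r a = z)).card = (P.filter (fun a => l a = z)).card := by omega
        rw [this]; ring
      · rw [hz z hzx hzx]; ring
  · have hf : ∀ f : ℤ → ℤ, ∑ a ∈ P, (f (r a) - f (l a)) =
        f x * (((P.filter (fun a => r a = x)).card : ℤ) -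
          ((P.filter (fun a => l a = x)).card : ℤ)) +
        f x' * (((P.filter (fun a => r a = x')).card : ℤ) -
          ((P.filter (fun a => l a = x')).card : ℤ)) := by
      intro f
      rw [h f, ← Finset.sum_subset (s₁ := {x, x'}), Finset.sum_pair hx]
      · intro z hz'
        simp only [Finset.mem_insert, Finset.mem_singleton] at hz' ⊢
        tauto
      · intro z _ hz'
        simp only [Finset.mem_insert, Finset.mem_singleton, not_or] at hz'
        rw [hz z hz'.1 hz'.2]; ring
    have hone := hf (fun _ => 1)
    have hid := hf id
    simp only [sub_self, Finset.sum_const_zero, one_mul] at hone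
    simp only [id] at hid
    rw [if_pos rfl, if_neg hx] at h4
    rw [if_neg (Ne.symm hx), if_pos rfl] at h4'
    rcases (show (((P.filter (fun a => r a = x)).card : ℤ) -
          ((P.filter (fun a => l a = x)).card : ℤ) = 1 ∧
          ((P.filter (fun a => r a = x')).card : ℤ) -
          ((P.filter (fun a => l a = x')).card : ℤ) = -1) ∨
        (((P.filter (fun a => r a = x)).card : ℤ) -
          ((P.filter (fun a => l a = x)).card : ℤ) = -1 ∧
          ((P.filter (fun a => r a = x')).card : ℤ) -
          ((P.filter (fun a => l a = x')).card : ℤ) = 1) by omega) with ⟨e1, e2⟩ | ⟨e1, e2⟩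
    · right
      rw [e1, e2] at hid
      rw [hid] at hd
      convert hd using 1; ring
    · left
      rw [e1, e2] at hid
      rw [hid] at hd
      convert hd using 1; ring

end Abstract
section Concrete

/-- which boundary a peripheral side belongs to; `none` for bridging arcs -/
def kind : Side → Option Bool
  | .arc (.bridging _ _) => none
  | .arc (.botPeriph _ _) => some false
  | .arc (.topPeriph _ _) => some true
  | .botSeg _ => some false
  | .topSeg _ => some true

def sl : Side → ℤ
  | .arc (.bridging x _) => x
  | .arc (.botPeriph u _) => u
  | .arc (.topPeriph u _) => u
  | .botSeg i => i
  | .topSeg i => i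

def sr : Side → ℤ
  | .arc (.bridging x _) => x
  | .arc (.botPeriph _ v) => v
  | .arc (.topPeriph _ v) => v
  | .botSeg i => i + 1
  | .topSeg i => i + 1

def foot : Bool → Side → Option ℤ
  | false, .arc (.bridging x _) => some x
  | true, .arc (.bridging _ y) => some y
  | _, _ => none

def ptOf : Bool → ℤ → Pt
  | false, z => .bot z
  | true, z => .top z

def EE {m p q : ℕ} (Γ : Angulation m p q) (b : Bool) : Set Side :=
  {s | kind s = some b ∧ ∀ a, s = Side.arc a → a ∈ Γ.arcs}

def PP (b : Bool) (F : Finset Side) : Finset Side := F.filter (fun s => kind s = some b)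

def bb (b : Bool) (F : Finset Side) (z : ℤ) : ℕ := (F.filter (fun s => foot b s = some z)).card

lemma EE_cases {m p q : ℕ} {Γ : Angulation m p q} {s : Side} (h : s ∈ EE Γ false) :
    (∃ i, s = .botSeg i) ∨ ∃ u v, s = .arc (.botPeriph u v) ∧ Arc.botPeriph u v ∈ Γ.arcs := by
  obtain ⟨h1, h2⟩ := h
  rcases s with (⟨x, y⟩ | ⟨u, v⟩ | ⟨u, v⟩) | i | i <;> simp [kind] at h1
  · exact Or.inr ⟨u, v, rfl, h2 _ rfl⟩
  · exact Or.inl ⟨i, rfl⟩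

lemma EE_cases' {m p q : ℕ} {Γ : Angulation m p q} {s : Side} (h : s ∈ EE Γ true) :
    (∃ i, s = .topSeg i) ∨ ∃ u v, s = .arc (.topPeriph u v) ∧ Arc.topPeriph u v ∈ Γ.arcs := by
  obtain ⟨h1, h2⟩ := h
  rcases s with (⟨x, y⟩ | ⟨u, v⟩ | ⟨u, v⟩) | i | i <;> simp [kind] at h1
  · exact Or.inr ⟨u, v, rfl, h2 _ rfl⟩
  · exact Or.inl ⟨i, rfl⟩

lemma periph_len {m : ℕ} {u v : ℤ} (h : ∃ k : ℤ, 1 ≤ k ∧ v = u + k * (m : ℤ) + 1) (hm : 2 ≤ m) :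
    u + 1 < v ∧ (m : ℤ) ∣ v - u - 1 := by
  obtain ⟨k, hk, rfl⟩ := h
  have : (2 : ℤ) ≤ m := by exact_mod_cast hm
  refine ⟨by nlinarith, k, by ring⟩

lemma sysE {m p q : ℕ} (Γ : Angulation m p q) (hm : 2 ≤ m) (b : Bool) :
    Sys sl sr m (EE Γ b) := by
  cases b
  · refine ⟨?_, ?_, ?_, ?_⟩
    · intro e he
      rcases EE_cases he with ⟨i, rfl⟩ | ⟨u, v, rfl, h⟩
      · simp [sl, sr]
      · have := periph_len (Γ.marc _ h) hm
        simp only [sl, sr]; omega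
    · intro e he
      rcases EE_cases he with ⟨i, rfl⟩ | ⟨u, v, rfl, h⟩
      · simp [sl, sr]
      · exact (periph_len (Γ.marc _ h) hm).2
    · intro a ha b hb h1 h2
      rcases EE_cases ha with ⟨i, rfl⟩ | ⟨u, v, rfl, h⟩ <;>
      rcases EE_cases hb with ⟨i', rfl⟩ | ⟨u', v', rfl, h'⟩
      · simp only [sl, sr] at h1 h2; subst h1; rfl
      · have := periph_len (Γ.marc _ h') hm
        simp only [sl, sr] at h1 h2; omega
      · have := periph_len (Γ.marc _ h) hm
        simp only [sl, sr] at h1 h2; omega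
      · simp only [sl, sr] at h1 h2; subst h1; subst h2; rfl
    · intro a ha b hb h0
      rcases EE_cases ha with ⟨i, rfl⟩ | ⟨u, v, rfl, h⟩ <;>
      rcases EE_cases hb with ⟨i', rfl⟩ | ⟨u', v', rfl, h'⟩ <;> simp only [sl, sr] at h0
      · omega
      · omega
      · omega
      · exact Γ.noncross _ h _ h' (Or.inl h0)
  · refine ⟨?_, ?_, ?_, ?_⟩
    · intro e he
      rcases EE_cases' he with ⟨i, rfl⟩ | ⟨u, v, rfl, h⟩
      · simp [sl, sr]
      · have := periph_len (Γ.marc _ h) hm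
        simp only [sl, sr]; omega
    · intro e he
      rcases EE_cases' he with ⟨i, rfl⟩ | ⟨u, v, rfl, h⟩
      · simp [sl, sr]
      · exact (periph_len (Γ.marc _ h) hm).2
    · intro a ha b hb h1 h2
      rcases EE_cases' ha with ⟨i, rfl⟩ | ⟨u, v, rfl, h⟩ <;>
      rcases EE_cases' hb with ⟨i', rfl⟩ | ⟨u', v', rfl, h'⟩
      · simp only [sl, sr] at h1 h2; subst h1; rfl
      · have := periph_len (Γ.marc _ h') hm
        simp only [sl, sr] at h1 h2; omega
      · have := periph_len (Γ.marc _ h) hm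
        simp only [sl, sr] at h1 h2; omega
      · simp only [sl, sr] at h1 h2; subst h1; subst h2; rfl
    · intro a ha b hb h0
      rcases EE_cases' ha with ⟨i, rfl⟩ | ⟨u, v, rfl, h⟩ <;>
      rcases EE_cases' hb with ⟨i', rfl⟩ | ⟨u', v', rfl, h'⟩ <;> simp only [sl, sr] at h0
      · omega
      · omega
      · omega
      · exact Γ.noncross _ h _ h' (Or.inl h0)

lemma face_arc {m p q : ℕ} {Γ : Angulation m p q} {F : Finset Side} (hF : F ∈ Γ.faces) {a : Arc}
    (ha : Side.arc a ∈ F) : a ∈ Γ.arcs := by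
  rcases Γ.face_sides F hF _ ha with ⟨a', h, h'⟩ | ⟨i, h⟩ | ⟨i, h⟩
  · cases h'; exact h
  · cases h
  · cases h

lemma mem_endpoints (b : Bool) (z : ℤ) (s : Side) : ptOf b z ∈ s.endpoints ↔
    (kind s = some b ∧ sl s = z) ∨ (kind s = some b ∧ sr s = z) ∨ foot b s = some z := by
  rcases s with (⟨x, y⟩ | ⟨u, v⟩ | ⟨u, v⟩) | i | i <;> cases b <;>
    simp [kind, sl, sr, foot, ptOf, Side.endpoints, Arc.endpoints, eq_comm]

lemma foot_none {b b' : Bool} {s : Side} (h : kind s = some b) : foot b' s = none := by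
  rcases s with (⟨x, y⟩ | ⟨u, v⟩ | ⟨u, v⟩) | i | i <;> cases b' <;> simp_all [kind, foot]

lemma faceD {m p q : ℕ} (Γ : Angulation m p q) (hm : 2 ≤ m) (b : Bool) {F : Finset Side}
    (hF : F ∈ Γ.faces) : FaceData sl sr (EE Γ b) (PP b F) (bb b F) := by
  have hsub : ∀ a ∈ PP b F, a ∈ EE Γ b := by
    intro a ha
    obtain ⟨h1, h2⟩ := Finset.mem_filter.1 ha
    exact ⟨h2, fun a' h => face_arc hF (h ▸ h1)⟩
  refine ⟨hsub, ?_, ?_⟩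
  · intro z
    have key : ((PP b F).filter (fun a => sl a = z)).card +
        ((PP b F).filter (fun a => sr a = z)).card + bb b F z =
        (F.filter (fun s => ptOf b z ∈ s.endpoints)).card := by
      simp only [PP, bb, Finset.filter_filter, Finset.card_filter, ← Finset.sum_add_distrib]
      refine Finset.sum_congr rfl fun s hs => ?_
      by_cases hk : kind s = some b
      · have hlt := (sysE Γ hm b).lt s (hsub s (Finset.mem_filter.2 ⟨hs, hk⟩))
        have hfo := foot_none (b' := b) hk
        simp only [mem_endpoints, hk, hfo, true_and]
        by_cases h1 : sl s = z <;> by_cases h2 : sr s = z <;> simp [h1, h2]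
        omega
      · simp [mem_endpoints, hk]
    rw [key]
    exact Γ.face_polygon F hF (ptOf b z)
  · intro z hz e he h0
    have : (F.filter (fun s => foot b s = some z)).Nonempty := by
      rw [← Finset.card_pos]; simp only [bb] at hz; omega
    obtain ⟨s, hs⟩ := this
    obtain ⟨hsF, hfo⟩ := Finset.mem_filter.1 hs
    rcases s with (⟨x, y⟩ | ⟨u, v⟩ | ⟨u, v⟩) | i | i <;> cases b <;> simp [foot] at hfo
    · subst hfo
      rcases EE_cases he with ⟨i, rfl⟩ | ⟨u, v, rfl, h⟩ <;> simp only [sl, sr] at h0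
      · omega
      · exact Γ.noncross _ (face_arc hF hsF) _ h h0
    · subst hfo
      rcases EE_cases' he with ⟨i, rfl⟩ | ⟨u, v, rfl, h⟩ <;> simp only [sl, sr] at h0
      · omega
      · exact Γ.noncross _ (face_arc hF hsF) _ h h0

/-- a peripheral side is outer in `F` if another side of `F` is nested under it -/
def Outer (F : Finset Side) (s : Side) : Prop :=
  ∃ b, kind s = some b ∧ (ins sl sr (PP b F) s).Nonempty

open Classical in
noncomputable def hh (F : Finset Side) (s : Side) : ℕ :=
  if kind s = none then 1 else if Outer F s then 2 else 0

noncomputable def WW (F : Finset Side) : ℕ := ∑ s ∈ F, hh F s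

lemma PP_card_le {m p q : ℕ} {Γ : Angulation m p q} {F : Finset Side} (hF : F ∈ Γ.faces)
    (b : Bool) : (PP b F).card ≤ m + 2 := by
  rw [← Γ.face_card F hF]; exact Finset.card_filter_le _ _

lemma outer_full {m p q : ℕ} {Γ : Angulation m p q} (hm : 2 ≤ m) {F : Finset Side}
    (hF : F ∈ Γ.faces) {s : Side} {b : Bool} (hs : s ∈ F) (hk : kind s = some b)
    (ho : (ins sl sr (PP b F) s).Nonempty) : PP b F = F := by
  have hsP : s ∈ PP b F := Finset.mem_filter.2 ⟨hs, hk⟩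
  obtain ⟨-, h1, h2⟩ := outer_struct (sysE Γ hm b) (faceD Γ hm b hF) (PP_card_le hF b) hsP ho
  apply Finset.eq_of_subset_of_card_le (Finset.filter_subset _ _)
  change F.card ≤ (PP b F).card
  rw [Γ.face_card F hF, h2, Finset.card_insert_of_notMem (by simp [mem_ins]), h1]

lemma outer_unique {m p q : ℕ} {Γ : Angulation m p q} (hm : 2 ≤ m) {F G : Finset Side}
    (hF : F ∈ Γ.faces) (hG : G ∈ Γ.faces) {s : Side} (hsF : s ∈ F) (hsG : s ∈ G)
    (hoF : Outer F s) (hoG : Outer G s) : F = G := by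
  obtain ⟨b, hk, h1⟩ := hoF
  obtain ⟨b', hk', h2⟩ := hoG
  have hbb : b' = b := by rw [hk] at hk'; simpa using hk'.symm
  subst hbb
  have hsPF : s ∈ PP b' F := Finset.mem_filter.2 ⟨hsF, hk⟩
  have hsPG : s ∈ PP b' G := Finset.mem_filter.2 ⟨hsG, hk⟩
  have e1 := outer_full hm hF hsF hk h1
  have e2 := outer_full hm hG hsG hk h2
  rw [← e1, ← e2]
  apply Finset.Subset.antisymm
  · exact outer_sub (sysE Γ hm b') (faceD Γ hm b' hG) (faceD Γ hm b' hF)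
      (PP_card_le hG b') (PP_card_le hF b') hsPG hsPF h2 h1
  · exact outer_sub (sysE Γ hm b') (faceD Γ hm b' hF) (faceD Γ hm b' hG)
      (PP_card_le hF b') (PP_card_le hG b') hsPF hsPG h1 h2

lemma nonest_of {F : Finset Side} (h : ∀ s ∈ F, ¬ Outer F s) (b : Bool) :
    NoNest sl sr (PP b F) := by
  intro a ha c hc hac
  by_contra hne
  obtain ⟨hc1, hc2⟩ := Finset.mem_filter.1 hc
  exact h c hc1 ⟨b, hc2, a, mem_ins.2 ⟨ha, hne, hac⟩⟩

/-- the bridging sides -/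
def BB (F : Finset Side) : Finset Side := F.filter (fun s => kind s = none)

lemma kind_none {s : Side} (h : kind s = none) : ∃ x y, s = .arc (.bridging x y) := by
  rcases s with (⟨x, y⟩ | ⟨u, v⟩ | ⟨u, v⟩) | i | i <;> simp [kind] at h
  exact ⟨x, y, rfl⟩

lemma bb_eq (b : Bool) (F : Finset Side) (z : ℤ) :
    bb b F z = ((BB F).filter (fun s => foot b s = some z)).card := by
  rw [bb, BB, Finset.filter_filter]
  congr 1
  apply Finset.filter_congr
  intro s _
  constructor
  · intro h
    refine ⟨?_, h⟩
    by_contra hk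
    obtain ⟨b', hb'⟩ := Option.ne_none_iff_exists'.1 hk
    rw [foot_none hb'] at h
    cases h
  · exact fun h => h.2

lemma card_split (F : Finset Side) :
    F.card = (PP false F).card + (PP true F).card + (BB F).card := by
  rw [Finset.card_eq_sum_ones F]
  simp only [PP, BB, Finset.card_filter, ← Finset.sum_add_distrib]
  refine Finset.sum_congr rfl fun s _ => ?_
  rcases s with (⟨x, y⟩ | ⟨u, v⟩ | ⟨u, v⟩) | i | i <;> simp [kind]

lemma BB_card_ge {m p q : ℕ} {Γ : Angulation m p q} (hm : 2 ≤ m) {F : Finset Side}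
    (hF : F ∈ Γ.faces) (h : ∀ s ∈ F, ¬ Outer F s) : 2 ≤ (BB F).card := by
  by_contra hlt
  have hc := card_split F
  rw [Γ.face_card F hF] at hc
  rcases (show (BB F).card = 0 ∨ (BB F).card = 1 by omega) with h0 | h1
  · have hB := Finset.card_eq_zero.1 h0
    have hbz : ∀ b z, bb b F z = 0 := by intro b z; rw [bb_eq, hB]; simp
    rcases (show 0 < (PP false F).card ∨ 0 < (PP true F).card by omega) with h' | h'
    · exact no_br_zero (sysE Γ hm _) (faceD Γ hm _ hF) (nonest_of h _) (Finset.card_pos.1 h') (hbz _)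
    · exact no_br_zero (sysE Γ hm _) (faceD Γ hm _ hF) (nonest_of h _) (Finset.card_pos.1 h') (hbz _)
  · obtain ⟨s, hs⟩ := Finset.card_eq_one.1 h1
    have hsB : s ∈ BB F := by rw [hs]; simp
    obtain ⟨x, y, rfl⟩ := kind_none (Finset.mem_filter.1 hsB).2
    refine no_br_one (faceD Γ hm false hF) (nonest_of h _) x ?_
    intro z
    rw [bb_eq, hs, Finset.filter_singleton]
    by_cases hz : z = x
    · simp [foot, hz]
    · simp [foot, hz, Ne.symm hz]

lemma hh_br {F : Finset Side} (h : ∀ s ∈ F, ¬ Outer F s) : WW F = (BB F).card := by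
  rw [WW, BB, Finset.card_filter]
  refine Finset.sum_congr rfl fun s hs => ?_
  simp [hh, h s hs]

lemma WW_ge {m p q : ℕ} {Γ : Angulation m p q} (hm : 2 ≤ m) {F : Finset Side}
    (hF : F ∈ Γ.faces) : 2 ≤ WW F := by
  by_cases h : ∀ s ∈ F, ¬ Outer F s
  · rw [hh_br h]; exact BB_card_ge hm hF h
  · push Not at h
    obtain ⟨s, hs, ho⟩ := h
    have : hh F s = 2 := by
      obtain ⟨b, hb, _⟩ := id ho
      simp [hh, hb, ho]
    rw [← this]
    exact Finset.single_le_sum (f := hh F) (fun _ _ => Nat.zero_le _) hs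

lemma final {m p q : ℕ} {Γ : Angulation m p q} (hm : 2 ≤ m) {F : Finset Side}
    (hF : F ∈ Γ.faces) (hW : WW F = 2)
    (hbot : ∃ i : ℤ, Side.botSeg i ∈ F) (htop : ∃ j : ℤ, Side.topSeg j ∈ F) :
    ∃ x y x' y' : ℤ,
      Side.arc (Arc.bridging x y) ∈ F ∧ Side.arc (Arc.bridging x' y') ∈ F ∧
      Arc.bridging x y ≠ Arc.bridging x' y' ∧
      (∀ z w : ℤ, Side.arc (Arc.bridging z w) ∈ F →
        Arc.bridging z w = Arc.bridging x y ∨ Arc.bridging z w = Arc.bridging x' y') ∧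
      ¬ (x ≡ x' [ZMOD (m : ℤ)]) := by
  obtain ⟨i, hi⟩ := hbot
  obtain ⟨j, hj⟩ := htop
  have hno : ∀ s ∈ F, ¬ Outer F s := by
    rintro s hs ⟨b, hk, ho⟩
    have h := outer_full hm hF hs hk ho
    rw [← h] at hi hj
    have h1 := (Finset.mem_filter.1 hi).2
    have h2 := (Finset.mem_filter.1 hj).2
    cases b <;> simp_all [kind]
  have hB : (BB F).card = 2 := by rw [← hh_br hno, hW]
  have hc := card_split F
  rw [Γ.face_card F hF] at hc
  have hPb : Side.botSeg i ∈ PP false F := Finset.mem_filter.2 ⟨hi, rfl⟩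
  have hPt : Side.topSeg j ∈ PP true F := Finset.mem_filter.2 ⟨hj, rfl⟩
  have c1 := Finset.card_pos.2 ⟨_, hPb⟩
  have c2 := Finset.card_pos.2 ⟨_, hPt⟩
  obtain ⟨s, t, hst, hBB⟩ := Finset.card_eq_two.1 hB
  have hs : s ∈ BB F := by rw [hBB]; simp
  have ht : t ∈ BB F := by rw [hBB]; simp
  obtain ⟨hsF, hs2⟩ := Finset.mem_filter.1 hs
  obtain ⟨htF, ht2⟩ := Finset.mem_filter.1 ht
  obtain ⟨x, y, rfl⟩ := kind_none hs2
  obtain ⟨x', y', rfl⟩ := kind_none ht2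
  refine ⟨x, y, x', y', hsF, htF, fun h => hst (by rw [h]), ?_, ?_⟩
  · intro z w hzw
    have : Side.arc (.bridging z w) ∈ BB F := Finset.mem_filter.2 ⟨hzw, rfl⟩
    rw [hBB] at this
    simpa using this
  · intro hx
    have hd : (m : ℤ) ∣ x' - x := hx.dvd
    have h2 := br_two (sysE Γ hm false) (faceD Γ hm false hF) (nonest_of hno false) ⟨_, hPb⟩ x x' (by
      intro z
      rw [bb_eq, hBB, Finset.card_filter, Finset.sum_pair hst]
      simp [foot, eq_comm])
    have h3 : (m : ℤ) ∣ ((PP false F).card : ℤ) := by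
      rcases h2 with h2 | h2
      · have := dvd_sub hd h2
        simpa using this
      · have := dvd_add hd h2
        have e : x' - x + (x - x' - ((PP false F).card : ℤ)) = -((PP false F).card : ℤ) := by ring
        rw [e] at this
        exact (dvd_neg.1 this)
    have := Int.le_of_dvd (by omega) h3
    omega

end Concrete
section Counting

lemma shiftSide_add (m p q : ℕ) (n k : ℤ) (s : Side) :
    shiftSide m p q n (shiftSide m p q k s) = shiftSide m p q (n + k) s := by
  rcases s with (⟨x, y⟩ | ⟨u, v⟩ | ⟨u, v⟩) | i | i <;> simp only [shiftSide, shiftArc] <;>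
    ring_nf

lemma shiftSide_zero (m p q : ℕ) (s : Side) : shiftSide m p q 0 s = s := by
  rcases s with (⟨x, y⟩ | ⟨u, v⟩ | ⟨u, v⟩) | i | i <;> simp [shiftSide, shiftArc]

/-- shift of a face -/
def shF (m p q : ℕ) (n : ℤ) (F : Finset Side) : Finset Side := F.image (shiftSide m p q n)

lemma shF_add (m p q : ℕ) (n k : ℤ) (F : Finset Side) :
    shF m p q n (shF m p q k F) = shF m p q (n + k) F := by
  simp only [shF, Finset.image_image]
  congr 1
  funext s
  exact shiftSide_add m p q n k s

lemma shF_zero (m p q : ℕ) (F : Finset Side) : shF m p q 0 F = F := by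
  have : shiftSide m p q 0 = id := funext (shiftSide_zero m p q)
  simp [shF, this]

lemma mem_shF {m p q : ℕ} {n : ℤ} {F : Finset Side} {s : Side} (h : s ∈ F) :
    shiftSide m p q n s ∈ shF m p q n F := Finset.mem_image_of_mem _ h

lemma shF_faces {m p q : ℕ} (Γ : Angulation m p q) (n : ℤ) (F : Finset Side) :
    F ∈ Γ.faces ↔ shF m p q n F ∈ Γ.faces := by
  induction n using Int.induction_on with
  | zero => rw [shF_zero]
  | succ k ih =>
    rw [ih, Γ.shift_face]
    change shF m p q 1 _ ∈ Γ.faces ↔ _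
    rw [shF_add, add_comm]
  | pred k ih =>
    rw [ih, Γ.shift_face (shF m p q (-(k : ℤ) - 1) F)]
    change _ ↔ shF m p q 1 _ ∈ Γ.faces
    rw [shF_add]
    have e : (1 : ℤ) + (-(k : ℤ) - 1) = -(k : ℤ) := by ring
    rw [e]

lemma shArc_arcs {m p q : ℕ} (Γ : Angulation m p q) (n : ℤ) (a : Arc) (ha : a ∈ Γ.arcs) :
    shiftArc m p q n a ∈ Γ.arcs := by
  obtain ⟨F, hF, _, _, _, h, _⟩ := Γ.arc_two_faces a ha
  exact face_arc ((shF_faces Γ n F).1 hF) (mem_shF (n := n) h)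

def level (m p q : ℕ) : Side → ℤ
  | .arc (.bridging x _) => x / ((m : ℤ) * p)
  | .arc (.botPeriph u _) => u / ((m : ℤ) * p)
  | .arc (.topPeriph u _) => u / ((m : ℤ) * q)
  | .botSeg i => i / ((m : ℤ) * p)
  | .topSeg i => i / ((m : ℤ) * q)

lemma level_shift {m p q : ℕ} (hm : 2 ≤ m) (hp : 1 ≤ p) (hq : 1 ≤ q) (n : ℤ) (s : Side) :
    level m p q (shiftSide m p q n s) = level m p q s + n := by
  have h1 : (m : ℤ) * p ≠ 0 := by positivity
  have h2 : (m : ℤ) * q ≠ 0 := by positivity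
  rcases s with (⟨x, y⟩ | ⟨u, v⟩ | ⟨u, v⟩) | i | i <;> simp only [shiftSide, shiftArc, level]
  all_goals first | exact Int.add_mul_ediv_right _ _ h1 | exact Int.add_mul_ediv_right _ _ h2

noncomputable def ml (m p q : ℕ) (F : Finset Side) : ℤ := sInf (level m p q '' (F : Set Side))

lemma ml_isLeast (m p q : ℕ) {F : Finset Side} (hF : F.Nonempty) :
    IsLeast (level m p q '' (F : Set Side)) (ml m p q F) := by
  obtain ⟨s, hs, hmin⟩ := F.exists_min_image (level m p q) hF
  have : IsLeast (level m p q '' (F : Set Side)) (level m p q s) := by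
    refine ⟨⟨s, hs, rfl⟩, ?_⟩
    rintro _ ⟨t, ht, rfl⟩
    exact hmin t ht
  rw [ml, this.csInf_eq]
  exact this

lemma ml_shift {m p q : ℕ} (hm : 2 ≤ m) (hp : 1 ≤ p) (hq : 1 ≤ q) (n : ℤ) {F : Finset Side}
    (hF : F.Nonempty) : ml m p q (shF m p q n F) = ml m p q F + n := by
  have h := ml_isLeast m p q hF
  have : IsLeast (level m p q '' (shF m p q n F : Set Side)) (ml m p q F + n) := by
    obtain ⟨⟨s, hs, hs'⟩, hmin⟩ := h
    refine ⟨⟨shiftSide m p q n s, mem_shF hs, by rw [level_shift hm hp hq, hs']⟩, ?_⟩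
    rintro _ ⟨t, ht, rfl⟩
    obtain ⟨t', ht', rfl⟩ := Finset.mem_image.1 ht
    rw [level_shift hm hp hq]
    have := hmin ⟨t', ht', rfl⟩
    omega
  rw [ml, this.csInf_eq]

lemma kind_shift (m p q : ℕ) (n : ℤ) (s : Side) : kind (shiftSide m p q n s) = kind s := by
  rcases s with (⟨x, y⟩ | ⟨u, v⟩ | ⟨u, v⟩) | i | i <;> rfl

def per (m p q : ℕ) : Bool → ℤ
  | false => (m : ℤ) * p
  | true => (m : ℤ) * q

lemma sl_shift (m p q : ℕ) (n : ℤ) {s : Side} {b : Bool} (h : kind s = some b) :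
    sl (shiftSide m p q n s) = sl s + n * per m p q b := by
  rcases s with (⟨x, y⟩ | ⟨u, v⟩ | ⟨u, v⟩) | i | i <;> cases b <;> simp [kind] at h <;> rfl

lemma sr_shift (m p q : ℕ) (n : ℤ) {s : Side} {b : Bool} (h : kind s = some b) :
    sr (shiftSide m p q n s) = sr s + n * per m p q b := by
  rcases s with (⟨x, y⟩ | ⟨u, v⟩ | ⟨u, v⟩) | i | i <;> cases b <;> simp [kind] at h <;>
    simp [shiftSide, shiftArc, sr, per] <;> ring

lemma outer_shift' {m p q : ℕ} (n : ℤ) {F : Finset Side} {s : Side} (h : Outer F s) :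
    Outer (shF m p q n F) (shiftSide m p q n s) := by
  obtain ⟨b, hk, a, ha⟩ := h
  obtain ⟨h1, h2, h3, h4⟩ := mem_ins.1 ha
  obtain ⟨haF, hka⟩ := Finset.mem_filter.1 h1
  refine ⟨b, by rw [kind_shift, hk], shiftSide m p q n a, mem_ins.2 ⟨Finset.mem_filter.2
    ⟨mem_shF haF, by rw [kind_shift, hka]⟩, ?_, ?_, ?_⟩⟩
  · intro h
    apply h2
    have := congrArg (shiftSide m p q (-n)) h
    simpa [shiftSide_add, shiftSide_zero] using this
  · rw [sl_shift m p q n hk, sl_shift m p q n hka]; omega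
  · rw [sr_shift m p q n hk, sr_shift m p q n hka]; omega

lemma outer_shift {m p q : ℕ} (n : ℤ) {F : Finset Side} {s : Side} :
    Outer (shF m p q n F) (shiftSide m p q n s) ↔ Outer F s := by
  refine ⟨fun h => ?_, outer_shift' n⟩
  have := outer_shift' (m := m) (p := p) (q := q) (-n) h
  simpa [shiftSide_add, shiftSide_zero, shF_add, shF_zero] using this

lemma hh_shift {m p q : ℕ} (n : ℤ) (F : Finset Side) (s : Side) :
    hh (shF m p q n F) (shiftSide m p q n s) = hh F s := by
  have h := outer_shift (m := m) (p := p) (q := q) n (F := F) (s := s)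
  by_cases ho : Outer F s
  · simp [hh, kind_shift, ho, h.2 ho]
  · have h2 : ¬ Outer (shF m p q n F) (shiftSide m p q n s) := fun h' => ho (h.1 h')
    simp [hh, kind_shift, ho, h2]

lemma face_ne {m p q : ℕ} {Γ : Angulation m p q} {F : Finset Side} (hF : F ∈ Γ.faces) :
    F.Nonempty := by
  rw [← Finset.card_pos, Γ.face_card F hF]; omega

/-- double counting of incidences between faces and sides, modulo the shift -/
lemma double_count {m p q : ℕ} (hm : 2 ≤ m) (hp : 1 ≤ p) (hq : 1 ≤ q) (Γ : Angulation m p q)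
    (c : ℤ) (D : Finset Side) (FA : Finset (Finset Side))
    (hD : ∀ s, s ∈ D ↔ level m p q s = c ∧ ∃ F ∈ Γ.faces, s ∈ F)
    (hFA : ∀ F, F ∈ FA ↔ F ∈ Γ.faces ∧ ∃ s ∈ F, level m p q s = c)
    (g : Finset Side → Side → ℕ)
    (hg : ∀ n F s, g (shF m p q n F) (shiftSide m p q n s) = g F s) :
    ∑ F ∈ FA.filter (fun F => ml m p q F = c), ∑ s ∈ F, g F s =
      ∑ s ∈ D, ∑ F ∈ FA.filter (fun F => s ∈ F), g F s := by
  have h1 : ∑ s ∈ D, ∑ F ∈ FA.filter (fun F => s ∈ F), g F s =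
      ∑ F ∈ FA, ∑ s ∈ F.filter (fun s => level m p q s = c), g F s := by
    apply Finset.sum_comm'
    intro s F
    simp only [Finset.mem_filter, hD, hFA]
    constructor
    · rintro ⟨⟨a, -⟩, ⟨b, b'⟩, d⟩
      exact ⟨⟨d, a⟩, b, b'⟩
    · rintro ⟨⟨d, a⟩, b, b'⟩
      exact ⟨⟨a, F, b, d⟩, ⟨b, b'⟩, d⟩
  rw [h1, Finset.sum_sigma', Finset.sum_sigma']
  have hcan : ∀ k n : ℤ, k + n = 0 → ∀ F s,
      (⟨shF m p q k (shF m p q n F), shiftSide m p q k (shiftSide m p q n s)⟩ :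
        (_ : Finset Side) × Side) = ⟨F, s⟩ := by
    intro k n h F s
    rw [shF_add, shiftSide_add, h, shF_zero, shiftSide_zero]
  refine Finset.sum_bij'
    (i := fun x _ => ⟨shF m p q (c - level m p q x.2) x.1,
      shiftSide m p q (c - level m p q x.2) x.2⟩)
    (j := fun x _ => ⟨shF m p q (c - ml m p q x.1) x.1,
      shiftSide m p q (c - ml m p q x.1) x.2⟩) ?_ ?_ ?_ ?_ ?_
  · rintro ⟨F, s⟩ hx
    simp only [Finset.mem_sigma, Finset.mem_filter, hFA] at hx ⊢
    obtain ⟨⟨⟨hF, -⟩, hml⟩, hs⟩ := hx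
    have e : level m p q (shiftSide m p q (c - level m p q s) s) = c := by
      rw [level_shift hm hp hq]; ring
    exact ⟨⟨(shF_faces Γ _ F).1 hF, _, mem_shF hs, e⟩, mem_shF hs, e⟩
  · rintro ⟨F, s⟩ hx
    simp only [Finset.mem_sigma, Finset.mem_filter, hFA] at hx ⊢
    obtain ⟨⟨hF, -⟩, hs, hl⟩ := hx
    have e : ml m p q (shF m p q (c - ml m p q F) F) = c := by
      rw [ml_shift hm hp hq _ (face_ne hF)]; ring
    have hF' := (shF_faces Γ (c - ml m p q F) F).1 hF
    obtain ⟨t, ht, ht'⟩ := (ml_isLeast m p q (face_ne hF')).1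
    exact ⟨⟨⟨hF', t, ht, by rw [ht', e]⟩, e⟩, mem_shF hs⟩
  · rintro ⟨F, s⟩ hx
    simp only [Finset.mem_sigma, Finset.mem_filter, hFA] at hx
    obtain ⟨⟨⟨hF, -⟩, hml⟩, hs⟩ := hx
    apply hcan
    rw [ml_shift hm hp hq _ (face_ne hF), hml]; ring
  · rintro ⟨F, s⟩ hx
    simp only [Finset.mem_sigma, Finset.mem_filter, hFA] at hx
    obtain ⟨⟨hF, -⟩, hs, hl⟩ := hx
    apply hcan
    rw [level_shift hm hp hq, hl]; ring
  · rintro ⟨F, s⟩ _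
    exact (hg _ F s).symm

lemma shiftSide_arc (m p q : ℕ) (n : ℤ) (a : Arc) :
    shiftSide m p q n (.arc a) = .arc (shiftArc m p q n a) := rfl

lemma arcs_level {m p q : ℕ} (hm : 2 ≤ m) (hp : 1 ≤ p) (hq : 1 ≤ q) (Γ : Angulation m p q)
    (c : ℤ) : ∃ A : Finset Side, A.card ≤ p + q ∧
      ∀ s, s ∈ A ↔ ∃ a ∈ Γ.arcs, s = .arc a ∧ level m p q s = c := by
  classical
  obtain ⟨reps, hcard, hsub, hall, -⟩ := Γ.orbit_count
  refine ⟨reps.image (fun r => shiftSide m p q (c - level m p q (.arc r)) (.arc r)),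
    by rw [← hcard]; exact Finset.card_image_le, ?_⟩
  intro s
  simp only [Finset.mem_image]
  constructor
  · rintro ⟨r, hr, rfl⟩
    exact ⟨_, shArc_arcs Γ (c - level m p q (.arc r)) r (hsub hr), rfl, by
      rw [level_shift hm hp hq]; ring⟩
  · rintro ⟨a, ha, rfl, hl⟩
    obtain ⟨r, hr, n, hn⟩ := hall a ha
    refine ⟨r, hr, ?_⟩
    rw [← hn, ← shiftSide_arc, shiftSide_add, level_shift hm hp hq, hl]
    have e : c - (c + n) + n = 0 := by ring
    rw [e, shiftSide_zero]

lemma WW_eq {m p q : ℕ} (hm : 2 ≤ m) (hp : 1 ≤ p) (hq : 1 ≤ q) (Γ : Angulation m p q)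
    {F0 : Finset Side} (hF0 : F0 ∈ Γ.faces) : WW F0 = 2 := by
  classical
  set c := ml m p q F0 with hc
  obtain ⟨A, hAc, hA⟩ := arcs_level hm hp hq Γ c
  have hmp : (0 : ℤ) < (m : ℤ) * p := by positivity
  have hmq : (0 : ℤ) < (m : ℤ) * q := by positivity
  set B := (Finset.Ico (c * ((m : ℤ) * p)) (c * ((m : ℤ) * p) + (m : ℤ) * p)).image Side.botSeg
    with hB
  set T := (Finset.Ico (c * ((m : ℤ) * q)) (c * ((m : ℤ) * q) + (m : ℤ) * q)).image Side.topSeg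
    with hT
  have hBm : ∀ s, s ∈ B ↔ ∃ i, s = .botSeg i ∧ level m p q s = c := by
    intro s
    simp only [hB, Finset.mem_image, Finset.mem_Ico]
    constructor
    · rintro ⟨i, hi, rfl⟩
      exact ⟨i, rfl, (Int.ediv_eq_iff_of_pos hmp).2 (by constructor <;> linarith [hi.1, hi.2])⟩
    · rintro ⟨i, rfl, h⟩
      have := (Int.ediv_eq_iff_of_pos hmp).1 h
      exact ⟨i, by constructor <;> linarith [this.1, this.2], rfl⟩
  have hTm : ∀ s, s ∈ T ↔ ∃ i, s = .topSeg i ∧ level m p q s = c := by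
    intro s
    simp only [hT, Finset.mem_image, Finset.mem_Ico]
    constructor
    · rintro ⟨i, hi, rfl⟩
      exact ⟨i, rfl, (Int.ediv_eq_iff_of_pos hmq).2 (by constructor <;> linarith [hi.1, hi.2])⟩
    · rintro ⟨i, rfl, h⟩
      have := (Int.ediv_eq_iff_of_pos hmq).1 h
      exact ⟨i, by constructor <;> linarith [this.1, this.2], rfl⟩
  have hBc : B.card = m * p := by
    rw [hB, Finset.card_image_of_injective _ (fun a b h => by cases h; rfl)]
    simp
    exact_mod_cast Int.toNat_natCast (m * p)
  have hTc : T.card = m * q := by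
    rw [hT, Finset.card_image_of_injective _ (fun a b h => by cases h; rfl)]
    simp
    exact_mod_cast Int.toNat_natCast (m * q)
  set D := A ∪ (B ∪ T) with hDdef
  have hBT : Disjoint B T := by
    rw [Finset.disjoint_left]
    intro s h1 h2
    obtain ⟨i, rfl, -⟩ := (hBm s).1 h1
    obtain ⟨j, h, -⟩ := (hTm _).1 h2
    cases h
  have hABT : Disjoint A (B ∪ T) := by
    rw [Finset.disjoint_left]
    intro s h1 h2
    obtain ⟨a, -, rfl, -⟩ := (hA s).1 h1
    rcases Finset.mem_union.1 h2 with h2 | h2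
    · obtain ⟨j, h, -⟩ := (hBm _).1 h2
      cases h
    · obtain ⟨j, h, -⟩ := (hTm _).1 h2
      cases h
  have hD : ∀ s, s ∈ D ↔ level m p q s = c ∧ ∃ F ∈ Γ.faces, s ∈ F := by
    intro s
    simp only [hDdef, Finset.mem_union, hA, hBm, hTm]
    constructor
    · rintro (⟨a, ha, rfl, h⟩ | ⟨i, rfl, h⟩ | ⟨i, rfl, h⟩)
      · obtain ⟨F, hF, _, _, _, h', _⟩ := Γ.arc_two_faces a ha
        exact ⟨h, F, hF, h'⟩
      · obtain ⟨F, hF, _⟩ := Γ.botSeg_face i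
        exact ⟨h, F, hF⟩
      · obtain ⟨F, hF, _⟩ := Γ.topSeg_face i
        exact ⟨h, F, hF⟩
    · rintro ⟨h, F, hF, hs⟩
      rcases Γ.face_sides F hF s hs with ⟨a, ha, rfl⟩ | ⟨i, rfl⟩ | ⟨i, rfl⟩
      · exact Or.inl ⟨a, ha, rfl, h⟩
      · exact Or.inr (Or.inl ⟨i, rfl, h⟩)
      · exact Or.inr (Or.inr ⟨i, rfl, h⟩)
  have hfin : ∀ s, {F | F ∈ Γ.faces ∧ s ∈ F}.Finite := by
    intro s
    by_cases hs : ∃ F ∈ Γ.faces, s ∈ F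
    · obtain ⟨F, hF, hsF⟩ := hs
      rcases Γ.face_sides F hF s hsF with ⟨a, ha, rfl⟩ | ⟨i, rfl⟩ | ⟨i, rfl⟩
      · obtain ⟨G, hG, H, hH, _, _, _, hall⟩ := Γ.arc_two_faces a ha
        refine Set.Finite.subset (Set.toFinite {G, H}) ?_
        rintro K ⟨hK, hK'⟩
        exact hall K hK hK'
      · obtain ⟨G, _, hu⟩ := Γ.botSeg_face i
        exact Set.Finite.subset (Set.finite_singleton G) (fun K hK => hu K hK)
      · obtain ⟨G, _, hu⟩ := Γ.topSeg_face i
        exact Set.Finite.subset (Set.finite_singleton G) (fun K hK => hu K hK)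
    · convert Set.finite_empty
      ext F
      simp only [Set.mem_ofPred_eq, Set.mem_empty_iff_false, iff_false]
      exact fun h => hs ⟨F, h⟩
  set FA : Finset (Finset Side) := D.biUnion (fun s => (hfin s).toFinset) with hFAdef
  have hFA : ∀ F, F ∈ FA ↔ F ∈ Γ.faces ∧ ∃ s ∈ F, level m p q s = c := by
    intro F
    simp only [hFAdef, Finset.mem_biUnion, Set.Finite.mem_toFinset, Set.mem_ofPred_eq, hD]
    constructor
    · rintro ⟨s, ⟨h, -⟩, hF, hs⟩
      exact ⟨hF, s, hs, h⟩
    · rintro ⟨hF, s, hs, h⟩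
      exact ⟨s, ⟨h, F, hF, hs⟩, hF, hs⟩
  have count := double_count hm hp hq Γ c D FA hD hFA
  have hlev : ∀ {s}, s ∈ D → level m p q s = c := fun h => ((hD _).1 h).1
  -- local counts
  have hAf : ∀ s ∈ A, ∃ F ∈ Γ.faces, ∃ G ∈ Γ.faces, F ≠ G ∧ s ∈ F ∧ s ∈ G ∧
      FA.filter (fun F => s ∈ F) = {F, G} := by
    intro s hs
    have hl := hlev (s := s) (Finset.mem_union_left _ hs)
    obtain ⟨a, ha, rfl, -⟩ := (hA s).1 hs
    obtain ⟨F, hF, G, hG, hne, h1, h2, hall⟩ := Γ.arc_two_faces a ha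
    refine ⟨F, hF, G, hG, hne, h1, h2, ?_⟩
    ext K
    simp only [Finset.mem_filter, hFA, Finset.mem_insert, Finset.mem_singleton]
    constructor
    · rintro ⟨⟨hK, -⟩, hK'⟩
      exact hall K hK hK'
    · rintro (rfl | rfl)
      · exact ⟨⟨hF, _, h1, hl⟩, h1⟩
      · exact ⟨⟨hG, _, h2, hl⟩, h2⟩
  have hSf : ∀ s ∈ B ∪ T, ∃ F ∈ Γ.faces, s ∈ F ∧ FA.filter (fun F => s ∈ F) = {F} := by
    intro s hs
    have hl := hlev (s := s) (Finset.mem_union_right _ hs)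
    have hex : ∃! F : Finset Side, F ∈ Γ.faces ∧ s ∈ F := by
      rcases Finset.mem_union.1 hs with hs | hs
      · obtain ⟨i, rfl, -⟩ := (hBm _).1 hs
        exact Γ.botSeg_face i
      · obtain ⟨i, rfl, -⟩ := (hTm _).1 hs
        exact Γ.topSeg_face i
    obtain ⟨F, ⟨hF, h1⟩, hu⟩ := hex
    refine ⟨F, hF, h1, ?_⟩
    ext K
    simp only [Finset.mem_filter, hFA, Finset.mem_singleton]
    constructor
    · rintro ⟨⟨hK, -⟩, hK'⟩
      exact hu K ⟨hK, hK'⟩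
    · rintro rfl
      exact ⟨⟨hF, _, h1, hl⟩, h1⟩
  -- number of faces
  set FD := FA.filter (fun F => ml m p q F = c) with hFD
  have hFDf : ∀ F ∈ FD, F ∈ Γ.faces := fun F h => ((hFA F).1 (Finset.mem_filter.1 h).1).1
  have n1 : FD.card * (m + 2) = 2 * A.card + (m * p + m * q) := by
    have h := count (fun _ _ => 1) (fun _ _ _ => rfl)
    rw [Finset.sum_congr rfl (g := fun _ => m + 2), hDdef, Finset.sum_union hABT] at h
    · rw [Finset.sum_congr (s₁ := A) rfl (g := fun _ => 2),
        Finset.sum_congr (s₁ := B ∪ T) rfl (g := fun _ => 1)] at h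
      · simp only [Finset.sum_const, smul_eq_mul, Finset.card_union_of_disjoint hBT, hBc, hTc,
          mul_one] at h
        rw [h]; ring
      · intro s hs
        obtain ⟨F, -, -, h'⟩ := hSf s hs
        rw [h']; simp
      · intro s hs
        obtain ⟨F, -, G, -, hne, -, -, h'⟩ := hAf s hs
        rw [h', Finset.sum_pair hne]
    · intro F hF
      simp [Γ.face_card F (hFDf F hF)]
  have n2 : ∑ F ∈ FD, WW F ≤ 2 * A.card := by
    have h := count hh hh_shift
    change ∑ F ∈ FD, WW F = _ at h
    rw [h, hDdef, Finset.sum_union hABT]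
    have hz : ∑ s ∈ B ∪ T, ∑ F ∈ FA.filter (fun F => s ∈ F), hh F s = 0 := by
      apply Finset.sum_eq_zero
      intro s hs
      apply Finset.sum_eq_zero
      intro F hF
      obtain ⟨hF1, hsF⟩ := Finset.mem_filter.1 hF
      have hFf := ((hFA F).1 hF1).1
      have hk : ∃ b, kind s = some b ∧ sr s = sl s + 1 := by
        rcases Finset.mem_union.1 hs with hs | hs
        · obtain ⟨i, rfl, -⟩ := (hBm _).1 hs
          exact ⟨false, rfl, rfl⟩
        · obtain ⟨i, rfl, -⟩ := (hTm _).1 hs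
          exact ⟨true, rfl, rfl⟩
      obtain ⟨b, hb, hlr⟩ := hk
      have hno : ¬ Outer F s := by
        rintro ⟨b', hb', a, ha⟩
        obtain ⟨h1, h2, h3, h4⟩ := mem_ins.1 ha
        have haE := (faceD Γ hm b' hFf).sub a h1
        have hsE := (faceD Γ hm b' hFf).sub s (Finset.mem_filter.2 ⟨hsF, hb'⟩)
        have := (sysE Γ hm b').lt a haE
        exact h2 ((sysE Γ hm b').inj a haE s hsE (by omega) (by omega))
      simp [hh, hb, hno]
    rw [hz, add_zero, mul_comm, ← smul_eq_mul]
    apply Finset.sum_le_card_nsmul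
    intro s hs
    obtain ⟨F, hF, G, hG, hne, h1, h2, h'⟩ := hAf s hs
    rw [h', Finset.sum_pair hne]
    by_cases hk : kind s = none
    · simp [hh, hk]
    · by_cases o1 : Outer F s
      · have o2 : ¬ Outer G s := fun o2 => hne (outer_unique hm hF hG h1 h2 o1 o2)
        simp [hh, hk, o1, o2]
      · simp only [hh, hk, o1, if_false]
        split_ifs <;> omega
  have hge : ∀ F ∈ FD, 2 ≤ WW F := fun F hF => WW_ge hm (hFDf F hF)
  have n3 : A.card ≤ FD.card := by
    by_contra hlt
    have : m * A.card ≤ m * p + m * q := by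
      rw [← mul_add]; exact Nat.mul_le_mul_left m hAc
    nlinarith
  have hsum : ∑ F ∈ FD, 2 = ∑ F ∈ FD, WW F := by
    apply le_antisymm (Finset.sum_le_sum hge)
    simp only [Finset.sum_const, smul_eq_mul]
    omega
  have hF0D : F0 ∈ FD := by
    obtain ⟨t, ht, ht'⟩ := (ml_isLeast m p q (face_ne hF0)).1
    exact Finset.mem_filter.2 ⟨(hFA F0).2 ⟨hF0, t, ht, ht'⟩, rfl⟩
  exact ((Finset.sum_eq_sum_iff_of_le hge).1 hsum F0 hF0D).symm

end Counting



/-- Let `m ≥ 2` and let `Γ` be an `(m+2)`-angulation of the annulus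
`A(p,q)`.  Let `F` be a face of `Γ` having among its sides at least one bottom
boundary segment and at least one top boundary segment.  Then exactly two sides of `F`
are bridging arcs, say `β(x,y)` and `β(x',y')`, and their bottom endpoints satisfy
`x ≢ x' (mod m)`; consequently the corresponding objects lie in different transjective
components of the Auslander–Reiten quiver of the `m`-cluster category (a bridging arc
`β(x,y)` lies in the transjective component labelled by the residue of `x` mod `m`). -/
theorem face_with_both_boundaries_has_two_bridging (m p q : ℕ) (hm : 2 ≤ m)
    (hp : 1 ≤ p) (hq : 1 ≤ q) (Γ : Angulation m p q)
    (F : Finset Side) (hF : F ∈ Γ.faces)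
    (hbot : ∃ i : ℤ, Side.botSeg i ∈ F) (htop : ∃ j : ℤ, Side.topSeg j ∈ F) :
    ∃ x y x' y' : ℤ,
      Side.arc (Arc.bridging x y) ∈ F ∧ Side.arc (Arc.bridging x' y') ∈ F ∧
      Arc.bridging x y ≠ Arc.bridging x' y' ∧
      (∀ z w : ℤ, Side.arc (Arc.bridging z w) ∈ F →
        Arc.bridging z w = Arc.bridging x y ∨ Arc.bridging z w = Arc.bridging x' y') ∧
      ¬ (x ≡ x' [ZMOD (m : ℤ)]) := by
  exact final hm hF (WW_eq hm hp hq Γ hF) hbot htop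

end ClusterAnnulus
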